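/- Let m(·):[s,r]→P²(K) be equal to m(·,s,α) for some distribution of controls α ∈ A_{s,r}[m(s)]. Then there exists a Borel velocity field v:[s,r]×ℝ^d→ℝ^d such that: (V1) v(t,x) ∈ co{f(t,x,m(t),u) : u∈U} (the convex hull) for almost every t∈[s,r] and m(t)-almost every x∈ℝ^d; and (V2) for every continuously differentiable function φ with compact support contained in (s,r)×ℝ^d, ∫_s^r ∫_{ℝ^d} (∂_tφ(t,x) + ⟨∇φ(t,x), v(t,x)⟩) m(t,dx) dt = 0, i.e., ∂_t m(t) + div(v(t,x)m(t)) = 0 holds in the sense of distributions. -/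

import Mathlib

open MeasureTheory Set
open scoped ENNReal NNReal

noncomputable section

/-- Euclidean space `ℝ^d`. -/
abbrev Euc (d : ℕ) := EuclideanSpace ℝ (Fin d)

/-- Probability measures on `ℝ^d` with finite second moment (`P²(ℝ^d)`). -/
def MemP2 {d : ℕ} (m : Measure (Euc d)) : Prop :=
  IsProbabilityMeasure m ∧ ∫⁻ x, (‖x‖₊ : ℝ≥0∞) ^ 2 ∂m < ⊤

/-- The measure `m` is supported in the (closed) set `K`. -/
def SuppIn {d : ℕ} (K : Set (Euc d)) (m : Measure (Euc d)) : Prop := m Kᶜ = 0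

/-- `P²(K)`: probability measures with finite second moment supported in `K`. -/
def MemP2K {d : ℕ} (K : Set (Euc d)) (m : Measure (Euc d)) : Prop := MemP2 m ∧ SuppIn K m

/-- Couplings (transport plans) between two measures on `ℝ^d`. -/
def Couplings {d : ℕ} (m₁ m₂ : Measure (Euc d)) : Set (Measure (Euc d × Euc d)) :=
  {π | IsProbabilityMeasure π ∧ π.map Prod.fst = m₁ ∧ π.map Prod.snd = m₂}

/-- Squared 2-Wasserstein distance. -/
def W2sq {d : ℕ} (m₁ m₂ : Measure (Euc d)) : ℝ :=
  sInf ((fun π : Measure (Euc d × Euc d) => ∫ p, ‖p.1 - p.2‖ ^ 2 ∂π) '' Couplings m₁ m₂)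

/-- 2-Wasserstein distance `W₂`. -/
def W2 {d : ℕ} (m₁ m₂ : Measure (Euc d)) : ℝ := Real.sqrt (W2sq m₁ m₂)

/-- An optimal plan between `m₁` and `m₂`. -/
def IsOptimalPlan {d : ℕ} (m₁ m₂ : Measure (Euc d)) (π : Measure (Euc d × Euc d)) : Prop :=
  π ∈ Couplings m₁ m₂ ∧ ∫ p, ‖p.1 - p.2‖ ^ 2 ∂π = W2sq m₁ m₂

/-- Standing assumptions (C1)–(C5) on the dynamics `f`. -/
structure DynHyp {d : ℕ} {U : Type} [TopologicalSpace U] (T R Cf : ℝ) (K : Set (Euc d))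
    (f : ℝ → Euc d → Measure (Euc d) → U → Euc d) : Prop where
  cont : ∀ m, Continuous fun p : ℝ × Euc d × U => f p.1 p.2.1 m p.2.2
  zero_outside : ∀ t x m u, SuppIn K m → x ∉ K → f t x m u = 0
  bounded : ∀ t x m u, t ∈ Icc 0 T → x ∈ K → MemP2K K m → ‖f t x m u‖ ≤ R
  lipschitz : ∀ t x x' m m' u, t ∈ Icc 0 T → x ∈ K → x' ∈ K → MemP2K K m → MemP2K K m' →
    ‖f t x m u - f t x' m' u‖ ≤ Cf * (‖x - x'‖ + W2 m m')

/-- Relaxed controls `U_{s,r}`: measures on `[s,r] × U` whose time marginal is Lebesgue. -/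
def RelaxedControls {U : Type} [MeasurableSpace U] (s r : ℝ) : Set (Measure (ℝ × U)) :=
  {ξ | ξ.map Prod.fst = volume.restrict (Icc s r)}

/-- `x(·) = x(·,s,y,m(·),ξ)` solves `ẋ(t) = ∫_U f(t,x(t),m(t),u) ξ(du|t)`, `x(s)=y`,
written in the equivalent integral form against the relaxed control `ξ`. -/
def IsTraj {d : ℕ} {U : Type} [MeasurableSpace U]
    (f : ℝ → Euc d → Measure (Euc d) → U → Euc d) (s r : ℝ)
    (m : ℝ → Measure (Euc d)) (ξ : Measure (ℝ × U)) (y : Euc d) (x : ℝ → Euc d) : Prop :=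
  Continuous x ∧ x s = y ∧ ∀ t ∈ Icc s r,
    x t = y + ∫ p in (Icc s t ×ˢ (univ : Set U)), f p.1 (x p.1) (m p.1) p.2 ∂ξ

/-- `A_{s,r}[m]`: distributions of pairs (initial state, relaxed control) with first marginal `m`. -/
def ControlDistrs {d : ℕ} (U : Type) [MeasurableSpace U] (s r : ℝ) (m : Measure (Euc d)) :
    Set (Measure (Euc d × Measure (ℝ × U))) :=
  {α | IsProbabilityMeasure α ∧ α.map Prod.fst = m ∧ ∀ᵐ p ∂α, p.2 ∈ RelaxedControls (U := U) s r}

/-- `m(·) = m(·,s,α)` is the motion of the mean field type control system produced by the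
initial time `s` and the distribution of controls `α`. -/
def IsMotion {d : ℕ} {U : Type} [MeasurableSpace U]
    (f : ℝ → Euc d → Measure (Euc d) → U → Euc d) (s r : ℝ) (mstar : Measure (Euc d))
    (α : Measure (Euc d × Measure (ℝ × U))) (m : ℝ → Measure (Euc d)) : Prop :=
  m s = mstar ∧ ∃ traj : Euc d × Measure (ℝ × U) → ℝ → Euc d,
    (∀ᵐ p ∂α, IsTraj f s r m p.2 p.1 (traj p)) ∧
    ∀ t ∈ Icc s r, m t = α.map fun p => traj p t

/-- Concatenation `ξ₀ ⋄_{s₁} ξ₁` of relaxed controls. -/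
def concatControl {U : Type} [MeasurableSpace U] (s₁ : ℝ) (ξ₀ ξ₁ : Measure (ℝ × U)) :
    Measure (ℝ × U) :=
  ξ₀.restrict ((Iio s₁) ×ˢ (univ : Set U)) + ξ₁.restrict ((Ici s₁) ×ˢ (univ : Set U))

/-- `α` is the concatenation `α₀ ⋄_{s₁} α₁` of distributions of controls: there are a motion of
`α₀` with trajectories `traj`, and a disintegration `β` of `α₁` w.r.t. its first marginal `m₁`,
such that `α` is obtained by concatenating controls along the trajectories. -/
def IsConcatDistr {d : ℕ} {U : Type} [MeasurableSpace U]
    (f : ℝ → Euc d → Measure (Euc d) → U → Euc d) (s₀ s₁ : ℝ) (m₀ m₁ : Measure (Euc d))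
    (α₀ α₁ α : Measure (Euc d × Measure (ℝ × U))) : Prop :=
  ∃ (mflow : ℝ → Measure (Euc d)) (traj : Euc d × Measure (ℝ × U) → ℝ → Euc d)
    (β : Euc d → Measure (Measure (ℝ × U))),
    IsMotion f s₀ s₁ m₀ α₀ mflow ∧
    (∀ᵐ p ∂α₀, IsTraj f s₀ s₁ mflow p.2 p.1 (traj p)) ∧
    α₁ = m₁.bind (fun y => (β y).map fun ξ => (y, ξ)) ∧
    α = α₀.bind fun p => (β (traj p s₁)).map fun ξ₁ => (p.1, concatControl s₁ p.2 ξ₁)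

/-- A (relaxed) feedback control at a single state: a weakly measurable family of probabilities
on `U`, i.e. the disintegration `ζ(du|t)` of an element of `U_{s,r}`. -/
def IsFeedback {U : Type} [MeasurableSpace U] [TopologicalSpace U] (ζ : ℝ → Measure U) : Prop :=
  (∀ t, IsProbabilityMeasure (ζ t)) ∧ ∀ g : C(U, ℝ), Measurable fun t => ∫ u, g u ∂(ζ t)

/-- Trajectory driven by a feedback (kernel-form) relaxed control `ζ(du|t)`. -/
def IsTrajKer {d : ℕ} {U : Type} [MeasurableSpace U]
    (f : ℝ → Euc d → Measure (Euc d) → U → Euc d) (s r : ℝ)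
    (m : ℝ → Measure (Euc d)) (ζ : ℝ → Measure U) (y : Euc d) (x : ℝ → Euc d) : Prop :=
  Continuous x ∧ x s = y ∧ ∀ t ∈ Icc s r,
    x t = y + ∫ t' in Icc s t, ∫ u, f t' (x t') (m t') u ∂(ζ t')

/-! ### Mean field Markov chains -/

/-- `Σ²`: summable nonnegative weights with total mass one and finite second moment. -/
def InSigma2 {d : ℕ} (S : Set (Euc d)) (μ : S → ℝ) : Prop :=
  (∀ x, 0 ≤ μ x) ∧ HasSum μ 1 ∧ Summable fun x : S => ‖(x : Euc d)‖ ^ 2 * μ x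

/-- The embedding `I : Σ² → P²(ℝ^d)`, `I(μ) = Σ_x̄ μ_x̄ δ_x̄`. -/
def Imeas {d : ℕ} (S : Set (Euc d)) (μ : S → ℝ) : Measure (Euc d) :=
  Measure.sum fun x : S => (Real.toNNReal (μ x)) • Measure.dirac (x : Euc d)

/-- `Q` is a Kolmogorov matrix (on the relevant domain). -/
def IsKolmogorov {d : ℕ} {U : Type} (S : Set (Euc d)) (T : ℝ)
    (Q : ℝ → (S → ℝ) → U → S → S → ℝ) : Prop :=
  ∀ t ∈ Icc 0 T, ∀ μ : S → ℝ, InSigma2 S μ → ∀ (u : U) (x : S),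
    (∀ y, x ≠ y → 0 ≤ Q t μ u x y) ∧ HasSum (Q t μ u x) 0

/-- The relaxed transition rate `𝒬_{x̄,ȳ}(t,μ,ζ_S) = ∫_U Q_{x̄,ȳ}(t,μ,u) ζ_x̄(du|t)`. -/
def Qbar {d : ℕ} {U : Type} [MeasurableSpace U] (S : Set (Euc d))
    (Q : ℝ → (S → ℝ) → U → S → S → ℝ) (ζ : S → ℝ → Measure U)
    (t : ℝ) (μ : S → ℝ) (x y : S) : ℝ :=
  ∫ u, Q t μ u x y ∂(ζ x t)

/-- Motion of the mean field Markov chain: the (integral form of the) nonlinear Kolmogorov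
equation `dμ_ȳ(t)/dt = Σ_x̄ μ_x̄(t) 𝒬_{x̄,ȳ}(t,μ(t),ζ_S)`, `μ(s) = μ*`. -/
def IsChainMotion {d : ℕ} {U : Type} [MeasurableSpace U] (S : Set (Euc d))
    (Q : ℝ → (S → ℝ) → U → S → S → ℝ) (s r : ℝ) (μstar : S → ℝ)
    (ζ : S → ℝ → Measure U) (μ : ℝ → S → ℝ) : Prop :=
  μ s = μstar ∧ ∀ t ∈ Icc s r, ∀ y : S,
    μ t y = μstar y + ∫ t' in Icc s t, ∑' x : S, μ t' x * Qbar S Q ζ t' (μ t') x y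

/-- (A1): `S` is an `ε`-net of `K`. -/
def CondA1 {d : ℕ} (S K : Set (Euc d)) (ε : ℝ) : Prop :=
  ∀ x ∈ K, ∃ y ∈ S, ‖x - y‖ ≤ ε

/-- (A2): the entries of `Q` are bounded by `B`. -/
def CondA2 {d : ℕ} {U : Type} (S : Set (Euc d)) (T : ℝ)
    (Q : ℝ → (S → ℝ) → U → S → S → ℝ) (B : ℝ) : Prop :=
  ∀ t ∈ Icc 0 T, ∀ μ : S → ℝ, InSigma2 S μ → ∀ (u : U) (x y : S), |Q t μ u x y| ≤ B

/-- (A3): the expected drift of the chain approximates `f` up to `ε`. -/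
def CondA3 {d : ℕ} {U : Type} (S : Set (Euc d)) (T : ℝ)
    (f : ℝ → Euc d → Measure (Euc d) → U → Euc d)
    (Q : ℝ → (S → ℝ) → U → S → S → ℝ) (ε : ℝ) : Prop :=
  ∀ t ∈ Icc 0 T, ∀ μ : S → ℝ, InSigma2 S μ → ∀ (u : U) (x : S),
    ‖f t (x : Euc d) (Imeas S μ) u - ∑' y : S, Q t μ u x y • ((y : Euc d) - (x : Euc d))‖ ≤ ε

/-- (A4): the quadratic variation rate of the chain is at most `ε²`. -/
def CondA4 {d : ℕ} {U : Type} (S : Set (Euc d)) (T : ℝ)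
    (Q : ℝ → (S → ℝ) → U → S → S → ℝ) (ε : ℝ) : Prop :=
  ∀ t ∈ Icc 0 T, ∀ μ : S → ℝ, InSigma2 S μ → ∀ (u : U) (x : S),
    ∑' y : S, Q t μ u x y * ‖(y : Euc d) - (x : Euc d)‖ ^ 2 ≤ ε ^ 2

/-- The generator `L_t[μ,ζ_S]φ` of the mean field Markov chain, extended by `0` off `S`. -/
def chainGen {d : ℕ} {U : Type} [MeasurableSpace U] (S : Set (Euc d))
    (Q : ℝ → (S → ℝ) → U → S → S → ℝ) (ζ : S → ℝ → Measure U) (μflow : ℝ → S → ℝ)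
    (φ : Euc d → ℝ) (t : ℝ) (z : Euc d) : ℝ :=
  open scoped Classical in
  if h : z ∈ S then ∑' y : S, Qbar S Q ζ t (μflow t) ⟨z, h⟩ y * φ (y : Euc d) else 0

/-- A realization of the flow `μ(·)` of the mean field Markov chain on `[s,r]`: a filtered
probability space with an adapted `S`-valued process `X` whose one-dimensional laws are `μ(·)`
and such that `φ(X(t)) - ∫_s^t L_{t'}[μ(t'),ζ_S]φ(X(t')) dt'` is a martingale for every
bounded `φ`. -/
def IsRealization {d : ℕ} {U : Type} [MeasurableSpace U] (S : Set (Euc d))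
    (Q : ℝ → (S → ℝ) → U → S → S → ℝ) (s r : ℝ) (ζ : S → ℝ → Measure U) (μ : ℝ → S → ℝ)
    {Ω : Type} [inst : MeasurableSpace Ω] (ℱ : ℝ → MeasurableSpace Ω) (P : Measure Ω)
    (X : ℝ → Ω → Euc d) : Prop :=
  IsProbabilityMeasure P ∧
  (∀ t, ℱ t ≤ inst) ∧ Monotone ℱ ∧
  (∀ t ∈ Icc s r, ∀ ω, X t ω ∈ S) ∧
  (∀ t ∈ Icc s r, Measurable[ℱ t] (X t)) ∧
  (∀ t ∈ Icc s r, ∀ x : S, μ t x = (P {ω | X t ω = (x : Euc d)}).toReal) ∧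
  ∀ φ : Euc d → ℝ, (∃ C, ∀ z, |φ z| ≤ C) →
    (∀ t ∈ Icc s r,
      Integrable (fun ω => φ (X t ω) - ∫ t' in Icc s t, chainGen S Q ζ μ φ t' (X t' ω)) P) ∧
    (∀ t₁ ∈ Icc s r, ∀ t₂ ∈ Icc s r, t₁ ≤ t₂ → ∀ A, MeasurableSet[ℱ t₁] A →
      ∫ ω in A, (φ (X t₂ ω) - ∫ t' in Icc s t₂, chainGen S Q ζ μ φ t' (X t' ω)) ∂P
        = ∫ ω in A, (φ (X t₁ ω) - ∫ t' in Icc s t₁, chainGen S Q ζ μ φ t' (X t' ω)) ∂P)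

/-- The model predictive flow (rules (D1)–(D2)) for the deterministic system, built from the
feedback strategy `ζ` of the chain and its motion `μ(·)` along the partition `σ`. -/
def IsMPCFlow {d : ℕ} {U : Type} [MeasurableSpace U]
    (f : ℝ → Euc d → Measure (Euc d) → U → Euc d) (S : Set (Euc d))
    (ζ : S → ℝ → Measure U) (μ : ℝ → S → ℝ) (n : ℕ) (σ : Fin (n + 1) → ℝ)
    (m₀ : Measure (Euc d)) (m : ℝ → Measure (Euc d)) : Prop :=
  m (σ 0) = m₀ ∧ ∀ k : Fin n,
    ∃ π : Measure (Euc d × Euc d),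
      IsOptimalPlan (m (σ k.castSucc)) (Imeas S (μ (σ k.castSucc))) π ∧
      ∃ x : Euc d × Euc d → ℝ → Euc d,
        (∀ᵐ p ∂π, ∃ h : p.2 ∈ S,
          IsTrajKer f (σ k.castSucc) (σ k.succ) m (ζ ⟨p.2, h⟩) p.1 (x p)) ∧
        ∀ t ∈ Icc (σ k.castSucc) (σ k.succ), m t = π.map fun p => x p t

open Filter Topology ProbabilityTheory

/-- The fundamental theorem of calculus for a compactly supported `C¹` function along an
absolutely continuous curve with bounded derivative. -/
lemma integral_fderiv_along_curve_eq_zero {E : Type*} [NormedAddCommGroup E] [NormedSpace ℝ E]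
    [CompleteSpace E] {s r C : ℝ} (hsr : s ≤ r) {b x : ℝ → E} {y : E}
    (hbm : StronglyMeasurable b) (hb : ∀ t, ‖b t‖ ≤ C)
    (hx : ∀ t ∈ Icc s r, x t = y + ∫ τ in Icc s t, b τ)
    {φ : ℝ × E → ℝ} (hφ : ContDiff ℝ 1 φ) (hφc : HasCompactSupport φ)
    (hφs : tsupport φ ⊆ Ioo s r ×ˢ univ) :
    ∫ t in Icc s r, fderiv ℝ φ (t, x t) (1, b t) = 0 := by
  have hint : ∀ a c, IntervalIntegrable b volume a c := fun a c =>
    (intervalIntegrable_const (c := C)).mono_fun hbm.aestronglyMeasurable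
      (.of_forall fun t => by
        simpa using (hb t).trans (le_abs_self C))
  set z : ℝ → E := fun t => y + ∫ τ in s..t, b τ with hz
  have hxz : ∀ t ∈ Icc s r, x t = z t := fun t ht => by
    simp only [hz]
    rw [hx t ht, intervalIntegral.integral_of_le ht.1, integral_Icc_eq_integral_Ioc]
  have hC : 0 ≤ C := (norm_nonneg _).trans (hb 0)
  have hzL : LipschitzWith ⟨C, hC⟩ z := by
    refine LipschitzWith.of_dist_le_mul fun t t' => ?_
    rw [dist_eq_norm, Real.dist_eq]
    have : z t - z t' = ∫ τ in t'..t, b τ := by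
      simp only [hz, add_sub_add_left_eq_sub]
      exact intervalIntegral.integral_interval_sub_left (hint _ _) (hint _ _)
    rw [this]
    exact intervalIntegral.norm_integral_le_of_norm_le_const fun t _ => hb t
  obtain ⟨L, hL⟩ := hφ.lipschitzWith_of_hasCompactSupport hφc (by simp)
  have hcurve := hL.comp (LipschitzWith.id.prodMk hzL)
  have hac := (hcurve.lipschitzOnWith (s := uIcc s r)).absolutelyContinuousOnInterval
  have hFTC := hac.integral_deriv_eq_sub
  have hend : ∀ t ∉ Ioo s r, ∀ e, φ (t, e) = 0 := fun t ht e =>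
    image_eq_zero_of_notMem_tsupport fun h => ht (hφs h).1
  simp only [Function.comp_apply, id] at hFTC
  rw [hend r (by simp), hend s (by simp), sub_zero] at hFTC
  rw [integral_Icc_eq_integral_Ioc, ← intervalIntegral.integral_of_le hsr, ← hFTC]
  refine intervalIntegral.integral_congr_ae ?_
  have hloc : LocallyIntegrable b volume := by
    refine (locallyIntegrable_const C).mono hbm.aestronglyMeasurable (.of_forall fun t => ?_)
    simpa using (hb t).trans (le_abs_self C)
  filter_upwards [LocallyIntegrable.ae_hasDerivAt_integral hloc] with t ht hts
  rw [uIoc_of_le hsr] at hts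
  have hd : HasDerivAt z (b t) t := (ht s).const_add y
  have h2 := ((hφ.differentiable (by simp)) (t, z t)).hasFDerivAt.comp_hasDerivAt t
    ((hasDerivAt_id t).prodMk hd)
  rw [hxz t ⟨hts.1.le, hts.2⟩]
  exact h2.deriv.symm

/-- Version of `integral_fderiv_along_curve_eq_zero` for a curve driven by a relaxed control. -/
lemma integral_fderiv_along_relaxed_curve_eq_zero {E : Type*} [NormedAddCommGroup E]
    [NormedSpace ℝ E] [CompleteSpace E] [SecondCountableTopology E] [MeasurableSpace E]
    [BorelSpace E] {U : Type*} [MeasurableSpace U] [StandardBorelSpace U] [Nonempty U]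
    {s r C : ℝ} (hsr : s ≤ r) {ξ : Measure (ℝ × U)}
    (hξ : ξ.map Prod.fst = volume.restrict (Icc s r)) {F : ℝ × U → E} (hFm : Measurable F)
    (hF : ∀ q, ‖F q‖ ≤ C) {x : ℝ → E} (hxc : Continuous x) {y : E}
    (hx : ∀ t ∈ Icc s r, x t = y + ∫ q in Icc s t ×ˢ univ, F q ∂ξ)
    {φ : ℝ × E → ℝ} (hφ : ContDiff ℝ 1 φ) (hφc : HasCompactSupport φ)
    (hφs : tsupport φ ⊆ Ioo s r ×ˢ univ) :
    ∫ q, fderiv ℝ φ (q.1, x q.1) (1, F q) ∂ξ = 0 := by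
  have : IsFiniteMeasure ξ := by
    constructor
    have h := congrArg (fun μ : Measure ℝ => μ univ) hξ
    simp only [Measure.map_apply measurable_fst MeasurableSet.univ, preimage_univ] at h
    rw [h]
    exact measure_lt_top _ _
  have hfst : ξ.fst = volume.restrict (Icc s r) := hξ
  have hFi : Integrable F ξ := .of_bound hFm.aestronglyMeasurable C (.of_forall hF)
  have hFsec : ∀ t, Integrable (fun u => F (t, u)) (ξ.condKernel t) := fun t =>
    .of_bound (hFm.comp measurable_prodMk_left).aestronglyMeasurable C (.of_forall fun u => hF _)
  set b : ℝ → E := fun t => ∫ u, F (t, u) ∂(ξ.condKernel t) with hb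
  have hbm : StronglyMeasurable b := hFm.stronglyMeasurable.integral_kernel_prod_right'
  have hbC : ∀ t, ‖b t‖ ≤ C := fun t => by
    simpa using norm_integral_le_of_norm_le_const (μ := ξ.condKernel t)
      (.of_forall fun u => hF (t, u))
  have hxb : ∀ t ∈ Icc s r, x t = y + ∫ τ in Icc s t, b τ := fun t ht => by
    rw [hx t ht, ← Measure.setIntegral_condKernel_univ_right measurableSet_Icc hFi.integrableOn,
      hfst, Measure.restrict_restrict measurableSet_Icc,
      inter_eq_left.2 (Icc_subset_Icc_right ht.2)]
  rw [← integral_fderiv_along_curve_eq_zero hsr hbm hbC hxb hφ hφc hφs]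
  obtain ⟨M, hM⟩ := (hφc.fderiv ℝ).exists_bound_of_continuous (hφ.continuous_fderiv (by simp))
  have hder : Measurable fun q : ℝ × U => fderiv ℝ φ (q.1, x q.1) (1, F q) := by
    have hc : Continuous fun q : (ℝ × E) × E => fderiv ℝ φ q.1 (1, q.2) :=
      ((hφ.continuous_fderiv (by simp)).comp continuous_fst).clm_apply (by fun_prop)
    exact hc.measurable.comp
      ((measurable_fst.prodMk (hxc.measurable.comp measurable_fst)).prodMk hFm)
  have hderi : Integrable (fun q : ℝ × U => fderiv ℝ φ (q.1, x q.1) (1, F q)) ξ := by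
    refine .of_bound hder.aestronglyMeasurable (M * max 1 C) (.of_forall fun q => ?_)
    refine (ContinuousLinearMap.le_of_opNorm_le _ (hM _) _).trans ?_
    refine mul_le_mul_of_nonneg_left ?_ ((norm_nonneg _).trans (hM (0, 0)))
    rw [Prod.norm_def]
    exact max_le_max (by simp) (hF q)
  rw [← Measure.integral_condKernel hderi, hfst]
  refine integral_congr_ae (.of_forall fun t => ?_)
  have h1 : Integrable (fun u => ((1 : ℝ), F (t, u))) (ξ.condKernel t) :=
    (integrable_const _).prodMk (hFsec t)
  change ∫ u, fderiv ℝ φ (t, x t) (1, F (t, u)) ∂(ξ.condKernel t) = _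
  rw [ContinuousLinearMap.integral_comp_comm _ h1, integral_pair (integrable_const _) (hFsec t)]
  simp [hb]

/-- A family of a.e. continuous curves whose evaluations on `[s, r]` are a.e. measurable has a
jointly measurable version with continuous curves. -/
lemma exists_measurable_version_of_ae_continuous {Ω E : Type*} [MeasurableSpace Ω]
    [NormedAddCommGroup E] [MeasurableSpace E] [BorelSpace E]
    {μ : Measure Ω} {s r : ℝ} (hsr : s ≤ r) {x : Ω → ℝ → E} (hc : ∀ᵐ ω ∂μ, Continuous (x ω))
    (hm : ∀ t ∈ Icc s r, AEMeasurable (fun ω => x ω t) μ) :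
    ∃ X : ℝ → Ω → E, Measurable (Function.uncurry X) ∧ (∀ ω, Continuous fun t => X t ω) ∧
      ∀ᵐ ω ∂μ, ∀ t ∈ Icc s r, X t ω = x ω t := by
  classical
  have : Nonempty (Icc s r) := ⟨⟨s, left_mem_Icc.2 hsr⟩⟩
  set D := TopologicalSpace.denseSeq (Icc s r) with hD
  have hDd : DenseRange D := TopologicalSpace.denseRange_denseSeq _
  have hae : ∀ᵐ ω ∂μ, Continuous (x ω) ∧ ∀ n, x ω (D n) = (hm (D n) (D n).2).mk _ ω :=
    hc.and (ae_all_iff.2 fun n => (hm (D n) (D n).2).ae_eq_mk)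
  obtain ⟨G, hG, hGm, hGx⟩ := hae.exists_measurable_mem
  set X : ℝ → Ω → E := fun t ω => if ω ∈ G then x ω (projIcc s r hsr t) else 0 with hX
  have hXc : ∀ ω, Continuous fun t => X t ω := fun ω => by
    by_cases hω : ω ∈ G
    · simp only [hX, hω, if_true]
      exact (hGx ω hω).1.comp (continuous_subtype_val.comp continuous_projIcc)
    · simp only [hX, hω, if_false]
      exact continuous_const
  have hXD : ∀ n, Measurable (X (D n)) := fun n => by
    have : X (D n) = fun ω => if ω ∈ G then (hm (D n) (D n).2).mk _ ω else 0 := by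
      ext1 ω
      by_cases hω : ω ∈ G
      · simp only [hX, hω, if_true, projIcc_val]
        exact (hGx ω hω).2 n
      · simp only [hX, hω, if_false]
    rw [this]
    exact Measurable.ite hGm (hm (D n) (D n).2).measurable_mk measurable_const
  have hXm : ∀ t, Measurable (X t) := fun t => by
    have hproj : X t = X (projIcc s r hsr t : ℝ) := by
      ext1 ω
      simp only [hX, projIcc_val]
    obtain ⟨k, hk, hklim⟩ := mem_closure_iff_seq_limit.1 (hDd (projIcc s r hsr t))
    rw [hproj]
    refine measurable_of_tendsto_metrizable (f := fun n => X (k n)) (fun n => ?_) ?_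
    · obtain ⟨j, hj⟩ := hk n
      rw [← hj]
      exact hXD j
    · refine tendsto_pi_nhds.2 fun ω => ?_
      exact ((hXc ω).comp continuous_subtype_val).continuousAt.tendsto.comp hklim
  refine ⟨X, measurable_uncurry_of_continuous_of_measurable hXc hXm, hXc, ?_⟩
  filter_upwards [hG] with ω hω t ht
  simp only [hX, hω, if_true, projIcc_of_mem hsr ht]

/-- In finite dimension, the convex hull of a compact set is compact. -/
lemma IsCompact.convexHull_of_finiteDimensional {E : Type*} [NormedAddCommGroup E]
    [NormedSpace ℝ E] [FiniteDimensional ℝ E] {S : Set E} (hS : IsCompact S) :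
    IsCompact (convexHull ℝ S) := by
  let comb : ∀ n : ℕ, (Fin n → ℝ) × (Fin n → E) → E := fun n q => ∑ i, q.1 i • q.2 i
  have hcomb : convexHull ℝ S = ⋃ n ∈ Finset.range (Module.finrank ℝ E + 2),
      comb n '' (stdSimplex ℝ (Fin n) ×ˢ Set.pi univ fun _ => S) := by
    refine Subset.antisymm (fun x hx => ?_) (iUnion₂_subset fun n _ => ?_)
    · obtain ⟨ι, hι, z, w, hz, hai, hw, hw1, rfl⟩ := eq_pos_convex_span_of_mem_convexHull hx
      have hcard : Fintype.card ι < Module.finrank ℝ E + 2 :=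
        Nat.lt_succ_of_le (hai.card_le_finrank_succ.trans
          (Nat.succ_le_succ (Submodule.finrank_le _)))
      let e := Fintype.equivFin ι
      refine mem_iUnion₂.2 ⟨Fintype.card ι, Finset.mem_range.2 hcard,
        (w ∘ e.symm, z ∘ e.symm), ⟨⟨fun i => (hw _).le, ?_⟩, fun i _ => hz (mem_range_self _)⟩, ?_⟩
      · exact (e.symm.sum_comp w).trans hw1
      · exact e.symm.sum_comp fun i => w i • z i
    · rintro _ ⟨⟨w, z⟩, ⟨hw, hz⟩, rfl⟩
      exact (convex_convexHull ℝ S).sum_mem (fun i _ => hw.1 i) hw.2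
        fun i _ => subset_convexHull ℝ S (hz i (mem_univ i))
  rw [hcomb]
  refine (Finset.range _).isCompact_biUnion fun n _ => ?_
  refine ((isCompact_stdSimplex ℝ (Fin n)).prod (isCompact_univ_pi fun _ => hS)).image ?_
  fun_prop

lemma W2_map_le {d : ℕ} {Ω : Type*} [MeasurableSpace Ω] {μ : Measure Ω} [IsProbabilityMeasure μ]
    {X Y : Ω → Euc d} (hX : Measurable X) (hY : Measurable Y) :
    W2 (μ.map X) (μ.map Y) ≤ Real.sqrt (∫ ω, ‖X ω - Y ω‖ ^ 2 ∂μ) := by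
  have hXY : Measurable fun ω => (X ω, Y ω) := hX.prodMk hY
  refine Real.sqrt_le_sqrt (csInf_le ⟨0, ?_⟩ ⟨μ.map fun ω => (X ω, Y ω), ⟨?_, ?_, ?_⟩, ?_⟩)
  · rintro _ ⟨π, -, rfl⟩
    exact integral_nonneg fun q => by positivity
  · exact Measure.isProbabilityMeasure_map hXY.aemeasurable
  · rw [Measure.map_map measurable_fst hXY]
    rfl
  · rw [Measure.map_map measurable_snd hXY]
    rfl
  · exact integral_map hXY.aemeasurable (by fun_prop)

/-- The laws of a uniformly bounded family of continuous perturbations of a fixed random point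
depend continuously on time in the distance `W₂`. -/
lemma tendsto_W2_map {d : ℕ} {Ω : Type*} [MeasurableSpace Ω] {μ : Measure Ω}
    [IsProbabilityMeasure μ] {I : Set ℝ} {X : ℝ → Ω → Euc d} (hX : ∀ t, Measurable (X t))
    (hc : ∀ ω, Continuous fun t => X t ω) {y : Ω → Euc d} {C : ℝ}
    (hb : ∀ᵐ ω ∂μ, ∀ t ∈ I, ‖X t ω - y ω‖ ≤ C) {t₀ : ℝ} (ht₀ : t₀ ∈ I) :
    Tendsto (fun t => W2 (μ.map (X t)) (μ.map (X t₀))) (𝓝[I] t₀) (𝓝 0) := by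
  refine squeeze_zero (g := fun t => Real.sqrt (∫ ω, ‖X t ω - X t₀ ω‖ ^ 2 ∂μ))
    (fun t => Real.sqrt_nonneg _) (fun t => W2_map_le (hX t) (hX t₀)) ?_
  have h0 : (0 : ℝ) = Real.sqrt (∫ _ω, (0 : ℝ) ∂μ) := by simp
  rw [h0]
  refine (Real.continuous_sqrt.tendsto _).comp ?_
  refine tendsto_integral_filter_of_dominated_convergence (fun _ => (C + C) ^ 2) ?_ ?_
    (integrable_const _) ?_
  · refine .of_forall fun t => Measurable.aestronglyMeasurable ?_
    exact ((hX t).sub (hX t₀)).norm.pow_const 2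
  · filter_upwards [self_mem_nhdsWithin] with t ht
    filter_upwards [hb] with ω hω
    rw [Real.norm_of_nonneg (by positivity)]
    refine pow_le_pow_left₀ (norm_nonneg _) ?_ 2
    calc ‖X t ω - X t₀ ω‖ = ‖(X t ω - y ω) - (X t₀ ω - y ω)‖ := by rw [sub_sub_sub_cancel_right]
      _ ≤ C + C := (norm_sub_le _ _).trans (add_le_add (hω t ht) (hω t₀ ht₀))
  · refine .of_forall fun ω => ?_
    have h : Continuous fun t => ‖X t ω - X t₀ ω‖ ^ 2 := by
      have := hc ω
      fun_prop
    have h' := (h.tendsto t₀).mono_left (nhdsWithin_le_nhds (s := I))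
    simpa using h'

/-- Along a `W₂`-continuous flow of measures the dynamics is jointly continuous in time, state and
control. -/
lemma DynHyp.continuousOn_along_flow {d : ℕ} {U : Type} [TopologicalSpace U] {T R Cf : ℝ}
    {K : Set (Euc d)} {f : ℝ → Euc d → Measure (Euc d) → U → Euc d} (hf : DynHyp T R Cf K f)
    {I : Set ℝ} (hI : I ⊆ Icc 0 T) {m : ℝ → Measure (Euc d)} (hm : ∀ t ∈ I, MemP2K K (m t))
    (hW : ∀ t₀ ∈ I, Tendsto (fun t => W2 (m t) (m t₀)) (𝓝[I] t₀) (𝓝 0)) :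
    ContinuousOn (fun q : (ℝ × Euc d) × U => f q.1.1 q.1.2 (m q.1.1) q.2)
      ((I ×ˢ K) ×ˢ univ) := by
  rintro ⟨⟨t₀, x₀⟩, u₀⟩ ⟨⟨ht₀, hx₀⟩, -⟩
  have h1 : Tendsto (fun q : (ℝ × Euc d) × U => f q.1.1 q.1.2 (m t₀) q.2)
      (𝓝[(I ×ˢ K) ×ˢ univ] ((t₀, x₀), u₀)) (𝓝 (f t₀ x₀ (m t₀) u₀)) := by
    have : Continuous fun q : (ℝ × Euc d) × U => f q.1.1 q.1.2 (m t₀) q.2 :=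
      (hf.cont (m t₀)).comp
        ((continuous_fst.comp continuous_fst).prodMk
          ((continuous_snd.comp continuous_fst).prodMk continuous_snd))
    exact (this.tendsto ((t₀, x₀), u₀)).mono_left nhdsWithin_le_nhds
  have hfst : Tendsto (fun q : (ℝ × Euc d) × U => q.1.1)
      (𝓝[(I ×ˢ K) ×ˢ univ] ((t₀, x₀), u₀)) (𝓝[I] t₀) :=
    ((continuous_fst.comp continuous_fst).continuousWithinAt
      (x := (((t₀, x₀), u₀) : (ℝ × Euc d) × U))).tendsto_nhdsWithin fun q hq => hq.1.1
  have h2 : Tendsto (fun q : (ℝ × Euc d) × U =>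
      f q.1.1 q.1.2 (m q.1.1) q.2 - f q.1.1 q.1.2 (m t₀) q.2)
      (𝓝[(I ×ˢ K) ×ˢ univ] ((t₀, x₀), u₀)) (𝓝 0) := by
    refine squeeze_zero_norm' (a := fun q => Cf * W2 (m q.1.1) (m t₀)) ?_ ?_
    · filter_upwards [self_mem_nhdsWithin] with q hq
      simpa using hf.lipschitz q.1.1 q.1.2 q.1.2 (m q.1.1) (m t₀) q.2 (hI hq.1.1) hq.1.2 hq.1.2
        (hm _ hq.1.1) (hm _ ht₀)
    · simpa using ((hW t₀ ht₀).comp hfst).const_mul Cf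
  rw [ContinuousWithinAt]
  simpa using h2.add h1

/-- Averages of a continuous map on a compact space lie in the convex hull of its range. -/
lemma integral_mem_convexHull_range {d : ℕ} {U : Type*} [TopologicalSpace U] [CompactSpace U]
    [MeasurableSpace U] [OpensMeasurableSpace U] {g : U → Euc d} (hg : Continuous g)
    (μ : Measure U) [IsProbabilityMeasure μ] : ∫ u, g u ∂μ ∈ convexHull ℝ (range g) := by
  have hK : IsCompact (range g) := isCompact_range hg
  refine (convex_convexHull ℝ _).integral_mem hK.convexHull_of_finiteDimensional.isClosed
    (.of_forall fun u => subset_convexHull ℝ _ (mem_range_self u)) ?_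
  obtain ⟨C, hC⟩ := hK.isBounded.exists_norm_le
  refine .of_bound hg.measurable.aestronglyMeasurable C (.of_forall fun u => hC _ ⟨u, rfl⟩)

/-- The dynamics along a flow of measures, extended by zero from the set of admissible times and
states. -/
def flowDynamics {d : ℕ} {U : Type} (f : ℝ → Euc d → Measure (Euc d) → U → Euc d)
    (m : ℝ → Measure (Euc d)) (I : Set ℝ) (K : Set (Euc d)) : (ℝ × Euc d) × U → Euc d :=
  ((I ×ˢ K) ×ˢ univ).indicator fun q => f q.1.1 q.1.2 (m q.1.1) q.2

lemma flowDynamics_of_mem {d : ℕ} {U : Type} {f : ℝ → Euc d → Measure (Euc d) → U → Euc d}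
    {m : ℝ → Measure (Euc d)} {I : Set ℝ} {K : Set (Euc d)} {t : ℝ} (ht : t ∈ I) {x : Euc d}
    (hx : x ∈ K) (u : U) : flowDynamics f m I K ((t, x), u) = f t x (m t) u :=
  indicator_of_mem (s := (I ×ˢ K) ×ˢ (univ : Set U)) ⟨⟨ht, hx⟩, mem_univ _⟩ _

/-- Trajectories starting from `y` and staying in `K` deviate from `y` by at most `R (r - s)`. -/
lemma IsTraj.norm_sub_le {d : ℕ} {U : Type} [MeasurableSpace U] [TopologicalSpace U]
    {T R Cf : ℝ} (hR : 0 ≤ R) {K : Set (Euc d)} {f : ℝ → Euc d → Measure (Euc d) → U → Euc d}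
    (hf : DynHyp T R Cf K f) {s r : ℝ} (hI : Icc s r ⊆ Icc 0 T) {m : ℝ → Measure (Euc d)}
    (hm : ∀ t ∈ Icc s r, MemP2K K (m t)) {ξ : Measure (ℝ × U)}
    (hξ : ξ ∈ RelaxedControls (U := U) s r) {y : Euc d} {x : ℝ → Euc d}
    (hx : IsTraj f s r m ξ y x) (hxK : ∀ t ∈ Icc s r, x t ∈ K) {t : ℝ} (ht : t ∈ Icc s r) :
    ‖x t - y‖ ≤ R * (r - s) := by
  have hmeas : ξ (Icc s t ×ˢ univ) = ENNReal.ofReal (t - s) := by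
    rw [prod_univ, ← Measure.map_apply measurable_fst measurableSet_Icc, hξ,
      Measure.restrict_apply measurableSet_Icc, inter_eq_left.2 (Icc_subset_Icc_right ht.2),
      Real.volume_Icc]
  rw [hx.2.2 t ht, add_sub_cancel_left]
  refine (norm_setIntegral_le_of_norm_le_const (C := R) ?_ ?_).trans ?_
  · rw [hmeas]
    exact ENNReal.ofReal_lt_top
  · intro q hq
    have hq' : q.1 ∈ Icc s r := Icc_subset_Icc_right ht.2 hq.1
    exact hf.bounded _ _ _ _ (hI hq') (hxK _ hq') (hm _ hq')
  · rw [measureReal_def, hmeas, ENNReal.toReal_ofReal (sub_nonneg.2 ht.1)]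
    exact mul_le_mul_of_nonneg_left (sub_le_sub_right ht.2 s) hR

/-- If the one-dimensional laws of a continuous process are carried by a closed set, then almost
all of its paths stay in that set. -/
lemma ae_forall_mem_of_isClosed {Ω E : Type*} [MeasurableSpace Ω] [TopologicalSpace E]
    {μ : Measure Ω} {s r : ℝ} {K : Set E} (hK : IsClosed K) {X : ℝ → Ω → E}
    (hc : ∀ ω, Continuous fun t => X t ω) (h : ∀ t ∈ Icc s r, ∀ᵐ ω ∂μ, X t ω ∈ K) :
    ∀ᵐ ω ∂μ, ∀ t ∈ Icc s r, X t ω ∈ K := by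
  rcases isEmpty_or_nonempty (Icc s r) with he | hne
  · exact .of_forall fun ω t ht => (he.false ⟨t, ht⟩).elim
  have hD : DenseRange (TopologicalSpace.denseSeq (Icc s r)) :=
    TopologicalSpace.denseRange_denseSeq _
  have hae : ∀ᵐ ω ∂μ, ∀ n, X (TopologicalSpace.denseSeq (Icc s r) n) ω ∈ K :=
    ae_all_iff.2 fun n => h _ (Subtype.prop _)
  filter_upwards [hae] with ω hω t ht
  have hcl : IsClosed {τ : Icc s r | X τ ω ∈ K} :=
    hK.preimage ((hc ω).comp continuous_subtype_val)
  have := hcl.closure_subset_iff.2 (range_subset_iff.2 hω) (hD ⟨t, ht⟩)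
  exact this

/-- first half of Proposition 3: every motion `m(·) = m(·,s,α)` of the mean
field type control system admits a Borel velocity field `v` such that (V1)
`v(t,x) ∈ co{f(t,x,m(t),u) : u ∈ U}` for a.e. `t ∈ [s,r]` and `m(t)`-a.e. `x`, and (V2)
the continuity equation `∂_t m + div(v m) = 0` holds in the sense of distributions. -/
theorem motion_gives_velocity_field
    {d : ℕ} {U : Type} [MetricSpace U] [CompactSpace U] [MeasurableSpace U] [BorelSpace U]
    (T R Cf : ℝ) (hT : 0 < T) (hR : 0 < R) (hCf : 0 < Cf)
    (K : Set (Euc d)) (hK : IsClosed K)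
    (f : ℝ → Euc d → Measure (Euc d) → U → Euc d) (hf : DynHyp T R Cf K f)
    (s r : ℝ) (hs : 0 ≤ s) (hsr : s < r) (hrT : r ≤ T)
    (m : ℝ → Measure (Euc d)) (hmP : ∀ t ∈ Icc s r, MemP2K K (m t))
    (α : Measure (Euc d × Measure (ℝ × U))) (hα : α ∈ ControlDistrs U s r (m s))
    (hm : IsMotion f s r (m s) α m) :
    ∃ v : ℝ → Euc d → Euc d,
      Measurable (fun p : ℝ × Euc d => v p.1 p.2) ∧
      (∀ᵐ t ∂(volume.restrict (Icc s r)), ∀ᵐ x ∂(m t),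
        v t x ∈ convexHull ℝ (Set.range fun u : U => f t x (m t) u)) ∧
      (∀ φ : ℝ × Euc d → ℝ, ContDiff ℝ 1 φ → HasCompactSupport φ →
        tsupport φ ⊆ (Ioo s r ×ˢ (univ : Set (Euc d))) →
        ∫ t in Icc s r, ∫ x, fderiv ℝ φ (t, x) (1, v t x) ∂(m t) = 0) := by
  obtain ⟨hαP, -, hαR⟩ := hα
  obtain ⟨-, traj, htraj, hmt⟩ := hm
  have hI : Icc s r ⊆ Icc 0 T := Icc_subset_Icc hs hrT
  have htrajm : ∀ t ∈ Icc s r, AEMeasurable (fun p => traj p t) α := fun t ht => by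
    by_contra h
    have h0 := hmt t ht
    rw [Measure.map_of_not_aemeasurable h] at h0
    have := (hmP t ht).1.1
    exact IsProbabilityMeasure.ne_zero (m t) h0
  obtain ⟨X, hXm, hXc, hXtraj⟩ := exists_measurable_version_of_ae_continuous hsr.le
    (htraj.mono fun p hp => hp.1) htrajm
  have hXt : ∀ t, Measurable (X t) := fun t => hXm.comp measurable_prodMk_left
  have hmX : ∀ t ∈ Icc s r, m t = α.map (X t) := fun t ht => by
    rw [hmt t ht]
    exact Measure.map_congr (hXtraj.mono fun p hp => (hp t ht).symm)
  have hXK : ∀ᵐ p ∂α, ∀ t ∈ Icc s r, X t p ∈ K := by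
    refine ae_forall_mem_of_isClosed hK hXc fun t ht => ?_
    refine ae_of_ae_map (hXt t).aemeasurable ?_
    rw [← hmX t ht]
    exact (hmP t ht).2
  have hXT : ∀ᵐ p ∂α, IsTraj f s r m p.2 p.1 fun t => X t p := by
    filter_upwards [htraj, hXtraj] with p hp hpX
    refine ⟨hXc p, (hpX s (left_mem_Icc.2 hsr.le)).trans hp.2.1, fun t ht => ?_⟩
    beta_reduce
    rw [hpX t ht, hp.2.2 t ht]
    refine congrArg _ (setIntegral_congr_fun (measurableSet_Icc.prod .univ) fun q hq => ?_)
    simp only [hpX q.1 (Icc_subset_Icc_right ht.2 hq.1)]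
  have hW : ∀ t₀ ∈ Icc s r, Tendsto (fun t => W2 (m t) (m t₀)) (𝓝[Icc s r] t₀) (𝓝 0) := by
    intro t₀ ht₀
    refine Tendsto.congr' ?_ (tendsto_W2_map (μ := α) (y := Prod.fst) (C := R * (r - s))
      hXt hXc ?_ ht₀)
    · filter_upwards [self_mem_nhdsWithin] with t ht
      rw [hmX t ht, hmX t₀ ht₀]
    · filter_upwards [hαR, hXT, hXK] with p hp1 hp2 hp3 t ht
      exact hp2.norm_sub_le hR.le hf hI hmP hp1 hp3 ht
  set w := flowDynamics f m (Icc s r) K with hw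
  have hwm : Measurable w := by
    have hS : MeasurableSet ((Icc s r ×ˢ K) ×ˢ (univ : Set U)) :=
      (measurableSet_Icc.prod hK.measurableSet).prod .univ
    have h := hf.continuousOn_along_flow hI hmP hW
    classical
    rw [hw, flowDynamics, ← piecewise_eq_indicator]
    exact h.measurable_piecewise continuousOn_const hS
  have hwR : ∀ q, ‖w q‖ ≤ R := fun q => by
    by_cases hq : q ∈ (Icc s r ×ˢ K) ×ˢ (univ : Set U)
    · rw [hw, flowDynamics, indicator_of_mem hq]
      exact hf.bounded _ _ _ _ (hI hq.1.1) hq.1.2 (hmP _ hq.1.1)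
    · rw [hw, flowDynamics, indicator_of_notMem hq, norm_zero]
      exact hR.le
  obtain ⟨G, hGα, hGm, hG⟩ := (hαR.and (hXT.and hXK)).exists_measurable_mem
  classical
  let κ : Kernel (Euc d × Measure (ℝ × U)) (ℝ × U) :=
    Kernel.piecewise hGm ⟨Prod.snd, measurable_snd⟩ 0
  have hκG : ∀ p ∈ G, κ p = p.2 := fun p hp => by
    simp only [κ, Kernel.piecewise_apply, if_pos hp]
    rfl
  have hκfst : ∀ p ∈ G, (κ p).map Prod.fst = volume.restrict (Icc s r) := fun p hp => by
    rw [hκG p hp]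
    exact (hG p hp).1
  have hκ : IsFiniteKernel κ := by
    refine ⟨⟨ENNReal.ofReal (r - s), ENNReal.ofReal_lt_top, fun p => ?_⟩⟩
    by_cases hp : p ∈ G
    · have h := congrArg (fun μ : Measure ℝ => μ univ) (hκfst p hp)
      simp only [Measure.map_apply measurable_fst MeasurableSet.univ, preimage_univ,
        Measure.restrict_apply_univ, Real.volume_Icc] at h
      exact h.le
    · simp [κ, Kernel.piecewise_apply, if_neg hp]
  have hU : Nonempty U := by
    by_contra hU
    rw [not_nonempty_iff] at hU
    obtain ⟨p, hp⟩ := hαR.exists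
    have h := congrArg (fun μ : Measure ℝ => μ univ) (hp : p.2.map Prod.fst = _)
    simp only [Measure.map_apply measurable_fst MeasurableSet.univ, preimage_univ,
      Measure.restrict_apply_univ, Real.volume_Icc, univ_eq_empty_iff.2
        (inferInstance : IsEmpty (ℝ × U)), measure_empty] at h
    exact (ENNReal.ofReal_pos.2 (sub_pos.2 hsr)).ne h
  let Z : (Euc d × Measure (ℝ × U)) × (ℝ × U) → (ℝ × Euc d) × U :=
    fun q => ((q.2.1, X q.2.1 q.1), q.2.2)
  have hZ : Measurable Z :=
    ((measurable_fst.comp measurable_snd).prodMk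
      (hXm.comp ((measurable_fst.comp measurable_snd).prodMk measurable_fst))).prodMk
      (measurable_snd.comp measurable_snd)
  let ρ : Measure ((ℝ × Euc d) × U) := (α ⊗ₘ κ).map Z
  have hρ : ρ.fst = (α ⊗ₘ κ).map fun q => (Z q).1 := Measure.map_map measurable_fst hZ
  have hwsec : ∀ z, Integrable (fun u => w (z, u)) (ρ.condKernel z) := fun z =>
    .of_bound (hwm.comp measurable_prodMk_left).aestronglyMeasurable R
      (.of_forall fun u => hwR _)
  let v : ℝ → Euc d → Euc d := fun t x => ∫ u, w ((t, x), u) ∂(ρ.condKernel (t, x))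
  have hvm : Measurable fun z : ℝ × Euc d => v z.1 z.2 :=
    (hwm.stronglyMeasurable.integral_kernel_prod_right' (κ := ρ.condKernel)).measurable
  have hvR : ∀ t x, ‖v t x‖ ≤ R := fun t x => by
    simpa using norm_integral_le_of_norm_le_const (μ := ρ.condKernel (t, x))
      (.of_forall fun u => hwR ((t, x), u))
  refine ⟨v, hvm, ?_, fun φ hφ hφc hφs => ?_⟩
  · filter_upwards [ae_restrict_mem measurableSet_Icc] with t ht
    have hmK : ∀ᵐ x ∂(m t), x ∈ K := (hmP t ht).2
    filter_upwards [hmK] with x hx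
    have hv : v t x = ∫ u, f t x (m t) u ∂(ρ.condKernel (t, x)) :=
      integral_congr_ae (.of_forall fun u => flowDynamics_of_mem ht hx u)
    rw [hv]
    refine integral_mem_convexHull_range ?_ _
    exact (hf.cont (m t)).comp (continuous_const.prodMk (continuous_const.prodMk continuous_id))
  · obtain ⟨M, hM⟩ := (hφc.fderiv ℝ).exists_bound_of_continuous (hφ.continuous_fderiv (by simp))
    have hdc : Continuous fun q : (ℝ × Euc d) × Euc d => fderiv ℝ φ q.1 (1, q.2) :=
      ((hφ.continuous_fderiv (by simp)).comp continuous_fst).clm_apply (by fun_prop)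
    have hdb : ∀ z e, ‖e‖ ≤ R → ‖fderiv ℝ φ z ((1 : ℝ), e)‖ ≤ M * max 1 R := fun z e he => by
      refine (ContinuousLinearMap.le_of_opNorm_le _ (hM _) _).trans ?_
      refine mul_le_mul_of_nonneg_left ?_ ((norm_nonneg _).trans (hM (0, 0)))
      rw [Prod.norm_def]
      exact max_le_max (by simp) he
    let g : ℝ × Euc d → ℝ := fun z => fderiv ℝ φ z (1, v z.1 z.2)
    have hgm : Measurable g := hdc.measurable.comp (measurable_id.prodMk hvm)
    have hgb : ∀ z, ‖g z‖ ≤ M * max 1 R := fun z => hdb _ _ (hvR _ _)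
    have hgw : ∀ z, g z = ∫ u, fderiv ℝ φ z (1, w (z, u)) ∂(ρ.condKernel z) := fun z => by
      have h1 : Integrable (fun u => ((1 : ℝ), w (z, u))) (ρ.condKernel z) :=
        (integrable_const _).prodMk (hwsec z)
      rw [ContinuousLinearMap.integral_comp_comm _ h1,
        integral_pair (integrable_const _) (hwsec z)]
      simp [g, v]
    let h : (ℝ × Euc d) × U → ℝ := fun q => fderiv ℝ φ q.1 (1, w q)
    have hhm : Measurable h := hdc.measurable.comp (measurable_fst.prodMk hwm)
    have hhb : ∀ q, ‖h q‖ ≤ M * max 1 R := fun q => hdb _ _ (hwR _)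
    have hXp : Measurable fun q : ℝ × (Euc d × Measure (ℝ × U)) => g (q.1, X q.1 q.2) :=
      hgm.comp (measurable_fst.prodMk hXm)
    calc ∫ t in Icc s r, ∫ x, g (t, x) ∂(m t)
        = ∫ t in Icc s r, ∫ p, g (t, X t p) ∂α := by
          refine setIntegral_congr_fun measurableSet_Icc fun t ht => ?_
          simp only [hmX t ht]
          exact integral_map (hXt t).aemeasurable
            (hgm.comp measurable_prodMk_left).aestronglyMeasurable
      _ = ∫ p, (∫ t in Icc s r, g (t, X t p)) ∂α :=
          integral_integral_swap (f := fun t p => g (t, X t p)) (.of_bound hXp.aestronglyMeasurable _ (.of_forall fun q => hgb _))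
      _ = ∫ p, ∫ q, g (q.1, X q.1 p) ∂(κ p) ∂α := by
          refine integral_congr_ae ?_
          filter_upwards [hGα] with p hp
          rw [← hκfst p hp]
          exact integral_map measurable_fst.aemeasurable
            (hgm.comp (measurable_id.prodMk (hXc p).measurable)).aestronglyMeasurable
      _ = ∫ q, g (Z q).1 ∂(α ⊗ₘ κ) :=
          (Measure.integral_compProd (.of_bound
            (hgm.comp (measurable_fst.comp hZ)).aestronglyMeasurable _
            (.of_forall fun q => hgb _))).symm
      _ = ∫ z, g z ∂ρ.fst := by
          rw [hρ]
          exact (integral_map (measurable_fst.comp hZ).aemeasurable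
            hgm.aestronglyMeasurable).symm
      _ = ∫ q, h q ∂ρ := by
          simp only [hgw]
          exact Measure.integral_condKernel (.of_bound hhm.aestronglyMeasurable _
            (.of_forall hhb))
      _ = ∫ q, h (Z q) ∂(α ⊗ₘ κ) := integral_map hZ.aemeasurable hhm.aestronglyMeasurable
      _ = ∫ p, ∫ q, h (Z (p, q)) ∂(κ p) ∂α :=
          Measure.integral_compProd (.of_bound (hhm.comp hZ).aestronglyMeasurable _
            (.of_forall fun q => hhb _))
      _ = ∫ p, (0 : ℝ) ∂α := by
          refine integral_congr_ae ?_
          filter_upwards [hGα] with p hp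
          obtain ⟨-, hpT, hpK⟩ := hG p hp
          refine integral_fderiv_along_relaxed_curve_eq_zero hsr.le (hκfst p hp)
            (F := fun q => w ((q.1, X q.1 p), q.2)) (C := R) (y := p.1) ?_ (fun q => hwR _)
            (hXc p) (fun t ht => ?_) hφ hφc hφs
          · exact hwm.comp ((measurable_fst.prodMk
              ((hXc p).measurable.comp measurable_fst)).prodMk measurable_snd)
          · rw [hκG p hp]
            refine (hpT.2.2 t ht).trans (congrArg _
              (setIntegral_congr_fun (measurableSet_Icc.prod .univ) fun q hq => ?_))
            have hq' : q.1 ∈ Icc s r := Icc_subset_Icc_right ht.2 hq.1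
            exact (flowDynamics_of_mem hq' (hpK _ hq') _).symm
      _ = 0 := by simp
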